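/- arXiv:1907.13068 — 2 statements merged into one kernel-verified Lean document; each statement's English description precedes it below -/
import Mathlib

section
/- Let q be a prime power, m ≥ 1, and d ∈ ℤ⁺ with d < q^m. Then every nonzero codeword of the square code HalfHyp_q(d,m)^{(2)} has Hamming weight at least d; in particular d(HalfHyp_q(d,m)^{(2)}) ≥ d. -/
/-- The affine code `C_A`: evaluations at all points of `F^m` of polynomials whose
monomial support lies in `A`. -/
noncomputable def affineCode (F : Type) [Field F] [Fintype F] (m : ℕ)
    (A : Set (Fin m → ℕ)) : Set ((Fin m → F) → F) :=
  {v | ∃ f : MvPolynomial (Fin m) F,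
        (∀ d ∈ f.support, (d : Fin m → ℕ) ∈ A) ∧ v = fun P => MvPolynomial.eval P f}

/-- The square code `C^{(2)}`: the span of all componentwise (Schur) products of
pairs of codewords of `C`. -/
noncomputable def squareCode (F : Type) [Field F] {n : Type} (C : Set (n → F)) :
    Set (n → F) :=
  (Submodule.span F {v | ∃ c₁ ∈ C, ∃ c₂ ∈ C, v = c₁ * c₂} : Submodule F (n → F))

/-- The half hyperbolic code `HalfHyp_q(d,m)` is `C_A` with
`A = {a ∈ ℕ^m : 2a_j ≤ q−1 for all j and ∏ (q−2a_j) ≥ d}`. -/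
noncomputable def halfHyp (F : Type) [Field F] [Fintype F] (d m : ℕ) :
    Set ((Fin m → F) → F) :=
  affineCode F m {a : Fin m → ℕ | (∀ j, 2 * a j ≤ Fintype.card F - 1) ∧
    d ≤ ∏ j, (Fintype.card F - 2 * a j)}



/-- The footprint bound: a nonzero polynomial has a monomial `s` in its support such that the
polynomial is nonzero at no fewer than `∏ (q - s i)` points. -/
theorem MvPolynomial.exists_mem_support_prod_card_sub_le (F : Type) [Field F] [Fintype F]
    [DecidableEq F] : ∀ (n : ℕ) (p : MvPolynomial (Fin n) F), p ≠ 0 →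
      ∃ s ∈ p.support, ∏ i, (Fintype.card F - s i) ≤
        (Finset.univ.filter fun x : Fin n → F => MvPolynomial.eval x p ≠ 0).card := by
  intro n
  induction n with
  | zero =>
    intro p hp
    obtain ⟨s, hs⟩ := MvPolynomial.support_nonempty.2 hp
    refine ⟨s, hs, ?_⟩
    rw [Finset.univ_eq_empty, Finset.prod_empty, Nat.one_le_iff_ne_zero, ← Nat.pos_iff_ne_zero,
      Finset.card_pos]
    refine ⟨0, Finset.mem_filter.2 ⟨Finset.mem_univ _, ?_⟩⟩
    rw [MvPolynomial.eq_C_of_isEmpty p] at hp ⊢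
    simpa using hp
  | succ n ih =>
    intro p hp
    set P := MvPolynomial.finSuccEquiv F n p with hP
    have hP0 : P ≠ 0 := by simpa [hP] using hp
    obtain ⟨s, hs, hle⟩ := ih P.leadingCoeff (by simpa using hP0)
    refine ⟨s.cons P.natDegree, MvPolynomial.mem_support_coeff_finSuccEquiv.1 hs, ?_⟩
    rw [Fin.prod_univ_succ]
    simp only [Finsupp.cons_zero, Finsupp.cons_succ]
    set G := Finset.univ.filter fun x : Fin n → F => MvPolynomial.eval x P.leadingCoeff ≠ 0
      with hG
    have fiber : ∀ x ∈ G, Fintype.card F - P.natDegree ≤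
        (Finset.univ.filter fun y : F =>
          MvPolynomial.eval (Fin.cons y x : Fin (n + 1) → F) p ≠ 0).card := by
      intro x hx
      have hx' : MvPolynomial.eval x P.leadingCoeff ≠ 0 := (Finset.mem_filter.1 hx).2
      set Q := P.map (MvPolynomial.eval x) with hQ
      have hQ0 : Q ≠ 0 := fun h => hx' (by
        have := congrArg (Polynomial.coeff · P.natDegree) h
        simpa [hQ, Polynomial.coeff_map] using this)
      have hz : (Finset.univ.filter fun y : F =>
          ¬ MvPolynomial.eval (Fin.cons y x : Fin (n + 1) → F) p ≠ 0).card ≤ P.natDegree := by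
        refine le_trans ?_ ((Polynomial.card_roots' Q).trans Polynomial.natDegree_map_le)
        refine le_trans (Finset.card_le_card ?_) Q.roots.toFinset_card_le
        intro y hy
        simp only [Finset.mem_filter, Finset.mem_univ, true_and, not_not] at hy
        rw [Multiset.mem_toFinset, Polynomial.mem_roots hQ0, Polynomial.IsRoot.def]
        rwa [MvPolynomial.eval_eq_eval_mv_eval'] at hy
      have := Finset.card_filter_add_card_filter_not (s := (Finset.univ : Finset F))
        (fun y : F => MvPolynomial.eval (Fin.cons y x : Fin (n + 1) → F) p ≠ 0)
      rw [Finset.card_univ] at this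
      omega
    calc (Fintype.card F - P.natDegree) * ∏ i, (Fintype.card F - s i)
        ≤ G.card * (Fintype.card F - P.natDegree) := by
          rw [mul_comm]; exact Nat.mul_le_mul_right _ hle
      _ ≤ ∑ x ∈ G, (Finset.univ.filter fun y : F =>
          MvPolynomial.eval (Fin.cons y x : Fin (n + 1) → F) p ≠ 0).card := by
          simpa using Finset.card_nsmul_le_sum G _ _ fiber
      _ = (G.sigma fun x => Finset.univ.filter fun y : F =>
          MvPolynomial.eval (Fin.cons y x : Fin (n + 1) → F) p ≠ 0).card :=
          (Finset.card_sigma _ _).symm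
      _ ≤ _ := by
          refine Finset.card_le_card_of_injOn
            (fun z => (Fin.cons z.2 z.1 : Fin (n + 1) → F)) ?_ ?_
          · intro z hz
            simpa using (Finset.mem_filter.1 (Finset.mem_sigma.1 hz).2).2
          · rintro ⟨x, y⟩ - ⟨x', y'⟩ - h
            obtain ⟨rfl, rfl⟩ := Fin.cons_inj.1 h
            rfl

/-- A codeword of the affine code `C_A` has weight at least `d` as soon as `d ≤ ∏ (q - a j)` for
all `a ∈ A`. -/
theorem le_hammingNorm_of_mem_affineCode (F : Type) [Field F] [Fintype F] [DecidableEq F]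
    {m d : ℕ} {A : Set (Fin m → ℕ)} (hA : ∀ a ∈ A, d ≤ ∏ j, (Fintype.card F - a j))
    {v : (Fin m → F) → F} (hv : v ∈ affineCode F m A) (hv0 : v ≠ 0) : d ≤ hammingNorm v := by
  obtain ⟨f, hf, rfl⟩ := hv
  have hf0 : f ≠ 0 := by
    rintro rfl
    exact hv0 (by ext; simp)
  obtain ⟨s, hs, hle⟩ := MvPolynomial.exists_mem_support_prod_card_sub_le F m f hf0
  exact (hA _ (hf s hs)).trans hle

open scoped Pointwise in
/-- The square of `C_A` is contained in `C_{A + A}`. -/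
theorem squareCode_affineCode_subset (F : Type) [Field F] [Fintype F] (m : ℕ)
    (A : Set (Fin m → ℕ)) : squareCode F (affineCode F m A) ⊆ affineCode F m (A + A) := by
  classical
  intro v hv
  refine Submodule.span_induction (p := fun v _ => v ∈ affineCode F m (A + A))
    ?_ ?_ ?_ ?_ hv
  · rintro _ ⟨_, ⟨f, hf, rfl⟩, _, ⟨g, hg, rfl⟩, rfl⟩
    refine ⟨f * g, fun s hs => ?_, by ext; simp⟩
    obtain ⟨a, ha, b, hb, rfl⟩ := Finset.mem_add.1 (MvPolynomial.support_mul f g hs)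
    exact ⟨a, hf a ha, b, hg b hb, rfl⟩
  · exact ⟨0, by simp, by ext; simp⟩
  · rintro _ _ - - ⟨f, hf, rfl⟩ ⟨g, hg, rfl⟩
    refine ⟨f + g, fun s hs => ?_, by ext; simp⟩
    exact (Finset.mem_union.1 (MvPolynomial.support_add hs)).elim (hf s) (hg s)
  · rintro c _ - ⟨f, hf, rfl⟩
    exact ⟨c • f, fun s hs => hf s (MvPolynomial.support_smul hs), by ext; simp⟩

/-- If `2a, 2b ≤ q`, then the products of the `q - 2a j` and of the `q - 2b j` being at least `d`
forces the product of the `q - (a j + b j)` to be at least `d`. -/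
theorem le_prod_sub_add_of_le_prod_sub_two_mul {ι : Type*} [Fintype ι] {q d : ℕ} {a b : ι → ℕ}
    (ha : ∀ j, 2 * a j ≤ q) (hb : ∀ j, 2 * b j ≤ q) (hda : d ≤ ∏ j, (q - 2 * a j))
    (hdb : d ≤ ∏ j, (q - 2 * b j)) : d ≤ ∏ j, (q - (a j + b j)) := by
  refine Nat.mul_self_le_mul_self_iff.1 ((Nat.mul_le_mul hda hdb).trans ?_)
  rw [← Finset.prod_mul_distrib, ← Finset.prod_mul_distrib]
  refine Finset.prod_le_prod' fun j _ => ?_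
  have hab : a j + b j ≤ q := by linarith [ha j, hb j]
  zify [ha j, hb j, hab]
  nlinarith [sq_nonneg ((a j : ℤ) - b j)]

theorem stmt9 (F : Type) [Field F] [Fintype F] [DecidableEq F]
    (m d : ℕ) (hm : 1 ≤ m) (hd : 1 ≤ d) (hdq : d < (Fintype.card F) ^ m) :
    ∀ v ∈ squareCode F (halfHyp F d m), v ≠ 0 → d ≤ hammingNorm v := by
  intro v hv
  refine le_hammingNorm_of_mem_affineCode F ?_ (squareCode_affineCode_subset F m _ hv)
  rintro _ ⟨a, ⟨ha, hda⟩, b, ⟨hb, hdb⟩, rfl⟩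
  exact le_prod_sub_add_of_le_prod_sub_two_mul (fun j => (ha j).trans (Nat.sub_le _ _))
    (fun j => (hb j).trans (Nat.sub_le _ _)) hda hdb
end

section
/- Let q be a prime power, m ≥ 1, and A ⊆ [0,q−1]^m nonempty. Let l be a positive divisor of q−1 and k ∈ ℕ with kl ≤ q−1, and suppose the footprint bound satisfies FB(C_A) = (q−kl)·q^{m−1}. If for some index i ∈ {1,…,m} the set A contains the zero vector and the vectors l·e_i, 2l·e_i, …, kl·e_i (where e_i is the i-th standard basis vector of ℕ^m), i.e., {1, X_i^l, X_i^{2l}, …, X_i^{kl}} ⊆ 𝔽_q[A], then the minimum distance of C_A equals FB(C_A). -/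
/-- The minimum distance of a code: the minimum Hamming weight of a nonzero codeword. -/
noncomputable def minDist (F : Type) [Field F] [Fintype F] [DecidableEq F] {m : ℕ}
    (C : Set ((Fin m → F) → F)) : ℕ :=
  sInf {w | ∃ v ∈ C, v ≠ 0 ∧ hammingNorm v = w}

section FootprintBound

open Finset

/-- A nonzero univariate polynomial of degree `n` over a finite field with `q` elements
has at least `q - n` non-roots. -/
theorem Polynomial.card_sub_natDegree_le_card_eval_ne_zero {F : Type*} [Field F] [Fintype F]
    [DecidableEq F] {p : Polynomial F} (hp : p ≠ 0) :
    Fintype.card F - p.natDegree ≤ #{x | p.eval x ≠ 0} := by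
  have hroots : #{x | p.eval x = 0} ≤ p.natDegree :=
    calc #{x | p.eval x = 0} ≤ #p.roots.toFinset := by
          refine card_le_card fun x hx => ?_
          simpa [hp] using hx
      _ ≤ Multiset.card p.roots := p.roots.toFinset_card_le
      _ ≤ p.natDegree := p.card_roots'
  have hsplit := card_filter_add_card_filter_not (s := (univ : Finset F)) (fun x => p.eval x = 0)
  rw [card_univ] at hsplit
  simp only [ne_eq]
  omega

/-- The **footprint bound**: a nonzero polynomial over a finite field with `q` elements has,
for some monomial `d` in its support, at least `∏ j, (q - d j)` non-zeros. -/
theorem MvPolynomial.exists_mem_support_prod_le_card_eval_ne_zero {F : Type*} [Field F]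
    [Fintype F] [DecidableEq F] :
    ∀ {n : ℕ} {f : MvPolynomial (Fin n) F}, f ≠ 0 →
      ∃ d ∈ f.support, ∏ j, (Fintype.card F - d j) ≤ #{P : Fin n → F | eval P f ≠ 0}
  | 0, f, hf => by
    obtain ⟨d, hd⟩ := support_nonempty.2 hf
    refine ⟨d, hd, ?_⟩
    rw [f.eq_C_of_isEmpty] at hf ⊢
    simp [C_ne_zero.mp hf]
  | n + 1, f, hf => by
    set p := finSuccEquiv F n f with hp
    have hp₀ : p ≠ 0 := EmbeddingLike.map_ne_zero_iff.2 hf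
    obtain ⟨s, hs, hle⟩ := exists_mem_support_prod_le_card_eval_ne_zero
      (Polynomial.leadingCoeff_ne_zero.2 hp₀)
    refine ⟨s.cons p.natDegree, mem_support_coeff_finSuccEquiv.1 hs, ?_⟩
    rw [Fin.prod_univ_succ]
    simp only [Finsupp.cons_zero, Finsupp.cons_succ]
    set T : Finset (Fin n → F) := {Q | eval Q p.leadingCoeff ≠ 0}
    calc (Fintype.card F - p.natDegree) * ∏ j, (Fintype.card F - s j)
        ≤ (Fintype.card F - p.natDegree) * #T := Nat.mul_le_mul_left _ hle
      _ ≤ #{P : Fin (n + 1) → F | eval P f ≠ 0 ∧ Fin.tail P ∈ T} := by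
        refine mul_card_image_le_card_of_maps_to (f := fun P : Fin (n + 1) → F => (Fin.tail P : Fin n → F))
          (fun P hP => (mem_filter.1 hP).2.2) _ fun Q hQ => ?_
        have hlead : eval Q p.leadingCoeff ≠ 0 := by simpa [T] using hQ
        have hdeg : (p.map (eval Q)).natDegree = p.natDegree :=
          Polynomial.natDegree_map_of_leadingCoeff_ne_zero _ hlead
        have hmap : p.map (eval Q) ≠ 0 := fun h => hlead <| by
          rw [Polynomial.leadingCoeff, ← Polynomial.coeff_map, h, Polynomial.coeff_zero]
        refine hdeg ▸ (Polynomial.card_sub_natDegree_le_card_eval_ne_zero hmap).trans ?_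
        refine card_le_card_of_injOn (fun x => (Fin.cons x Q : Fin (n + 1) → F)) ?_
          (Fin.cons_left_injective (α := fun _ => F) Q).injOn
        intro x hx
        simpa [eval_eq_eval_mv_eval', hQ] using hx
      _ ≤ _ := card_le_card fun P hP => by simp_all

/-- If `l` divides `q - 1` and `k * l ≤ q - 1`, there is a set of `k` nonzero elements such that
at most `q - k * l` elements have their `l`-th power outside of it. -/
theorem exists_card_pow_notMem_le {F : Type*} [Field F] [Fintype F] [DecidableEq F]
    {l k : ℕ} (hl : 1 ≤ l) (hldvd : l ∣ Fintype.card F - 1) (hkl : k * l ≤ Fintype.card F - 1) :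
    ∃ T : Finset F, #T = k ∧ 0 ∉ T ∧ #{x : F | x ^ l ∉ T} ≤ Fintype.card F - k * l := by
  obtain ⟨n, hn⟩ := hldvd
  have hq : 1 < Fintype.card F := Fintype.one_lt_card
  have hn₀ : 0 < n := by
    rcases Nat.eq_zero_or_pos n with rfl | h
    · omega
    · exact h
  set U : Finset F := univ.erase 0 with hU
  have hUcard : #U = Fintype.card F - 1 := by simp [hU]
  set I : Finset F := U.image (· ^ l) with hI
  have hfiber (y : F) : #{x ∈ U | x ^ l = y} ≤ l :=
    calc #{x ∈ U | x ^ l = y} ≤ #(Polynomial.nthRoots l y).toFinset :=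
          card_le_card fun x hx => by
            simp only [mem_filter] at hx
            simp [Polynomial.mem_nthRoots hl, hx.2]
      _ ≤ l := (Multiset.toFinset_card_le _).trans (Polynomial.card_nthRoots l y)
  have hIn : #I ≤ n :=
    calc #I ≤ #(Polynomial.nthRoots n (1 : F)).toFinset := by
          refine card_le_card fun y hy => ?_
          obtain ⟨x, hx, rfl⟩ := mem_image.1 hy
          have hx₀ : x ≠ 0 := by simpa [hU] using hx
          simp [Polynomial.mem_nthRoots hn₀, ← pow_mul, ← hn,
            FiniteField.pow_card_sub_one_eq_one x hx₀]
      _ ≤ n := (Multiset.toFinset_card_le _).trans (Polynomial.card_nthRoots n 1)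
  have hkI : k ≤ #I := by
    have h : #U ≤ l * #I := card_le_mul_card_image U l fun y _ => hfiber y
    refine Nat.le_of_mul_le_mul_left (c := l) ?_ hl
    rw [mul_comm l k]
    omega
  obtain ⟨T, hTI, hT⟩ := exists_subset_card_eq hkI
  refine ⟨T, hT, fun h => ?_, ?_⟩
  · obtain ⟨x, hx, hx'⟩ := mem_image.1 (hTI h)
    exact pow_ne_zero l (by simpa [hU] using hx) hx'
  have hsub : ({x : F | x ^ l ∉ T} : Finset F) ⊆ insert 0 {x ∈ U | x ^ l ∉ T} := by
    intro x hx
    by_cases hx₀ : x = 0 <;> simp_all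
  have hle : #{x ∈ U | x ^ l ∉ T} ≤ l * #(I \ T) := by
    refine card_le_mul_card_image_of_maps_to (f := (· ^ l)) (fun x hx => ?_) l fun y _ => ?_
    · obtain ⟨hxU, hxT⟩ := mem_filter.1 hx
      exact mem_sdiff.2 ⟨mem_image_of_mem _ hxU, hxT⟩
    · exact (card_le_card (filter_subset_filter _ (filter_subset _ _))).trans (hfiber y)
  have hsdiff : l * #(I \ T) ≤ Fintype.card F - 1 - k * l := by
    rw [card_sdiff_of_subset hTI, hT, hn, mul_comm k l, ← Nat.mul_sub]
    exact Nat.mul_le_mul_left l (by omega)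
  have := (card_le_card hsub).trans (card_insert_le _ _)
  omega

/-- The points whose `i`-th coordinate lies in `S` number `#S * q ^ (m - 1)`. -/
theorem card_filter_apply_mem {F : Type*} [Fintype F] [DecidableEq F] {m : ℕ} (i : Fin m)
    (S : Finset F) : #{P : Fin m → F | P i ∈ S} = #S * Fintype.card F ^ (m - 1) := by
  have h : ({P : Fin m → F | P i ∈ S} : Finset _) =
      Fintype.piFinset fun j => if j = i then S else univ := by
    ext P
    simp only [mem_filter, mem_univ, true_and, Fintype.mem_piFinset]
    refine ⟨fun h j => ?_, fun h => by simpa using h i⟩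
    split_ifs with hj
    · exact hj ▸ h
    · exact mem_univ _
  rw [h, Fintype.card_piFinset, ← mul_prod_erase univ _ (mem_univ i), if_pos rfl,
    prod_congr rfl (fun j hj => by rw [if_neg (ne_of_mem_erase hj)])]
  simp

theorem inf'_le_hammingNorm {F : Type} [Field F] [Fintype F] [DecidableEq F] {m : ℕ}
    {A : Finset (Fin m → ℕ)} (hA : A.Nonempty) {v : (Fin m → F) → F}
    (hv : v ∈ affineCode F m ↑A) (hv₀ : v ≠ 0) :
    A.inf' hA (fun a => ∏ i, (Fintype.card F - a i)) ≤ hammingNorm v := by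
  obtain ⟨f, hf, rfl⟩ := hv
  have hf₀ : f ≠ 0 := by
    rintro rfl
    exact hv₀ (by ext; simp)
  obtain ⟨d, hd, hle⟩ := MvPolynomial.exists_mem_support_prod_le_card_eval_ne_zero hf₀
  exact (inf'_le _ (mem_coe.1 (hf d hd))).trans hle

/-- If the exponents `0, l, 2l, …, kl` of the `i`-th variable are allowed, then the code contains
the evaluation of `p (X_i ^ l)` for every univariate `p` of degree at most `k`. -/
theorem eval_pow_mem_affineCode {F : Type} [Field F] [Fintype F] {m : ℕ}
    {A : Set (Fin m → ℕ)} {l k : ℕ} {i : Fin m}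
    (hmem : ∀ t ≤ k, (fun j => if j = i then t * l else 0) ∈ A)
    {p : Polynomial F} (hp : p.natDegree ≤ k) :
    (fun P => p.eval (P i ^ l)) ∈ affineCode F m A := by
  classical
  refine ⟨∑ t ∈ range (k + 1), MvPolynomial.monomial (Finsupp.single i (t * l)) (p.coeff t),
    fun d hd => ?_, ?_⟩
  · obtain ⟨t, ht, hdt⟩ := mem_biUnion.1 (MvPolynomial.support_sum hd)
    obtain rfl := mem_singleton.1 (MvPolynomial.support_monomial_subset hdt)
    convert hmem t (Nat.lt_succ_iff.1 (mem_range.1 ht)) using 1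
    ext j
    simp only [Finsupp.single_apply, eq_comm]
  · ext P
    simp only [Polynomial.eval_eq_sum_range' (Nat.lt_succ_of_le hp), map_sum,
      MvPolynomial.eval_monomial, Finsupp.prod_single_index, pow_zero, ← pow_mul, mul_comm l]

end FootprintBound

theorem stmt19 (F : Type) [Field F] [Fintype F] [DecidableEq F]
    (m : ℕ) (hm : 1 ≤ m) (A : Finset (Fin m → ℕ)) (hA : A.Nonempty)
    (hbox : ∀ a ∈ A, ∀ i, a i ≤ Fintype.card F - 1)
    (l k : ℕ) (hl : 1 ≤ l) (hldvd : l ∣ Fintype.card F - 1)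
    (hkl : k * l ≤ Fintype.card F - 1)
    (hFB : A.inf' hA (fun a => ∏ i, (Fintype.card F - a i)) =
      (Fintype.card F - k * l) * (Fintype.card F) ^ (m - 1))
    (i : Fin m)
    (hmem : ∀ t ≤ k, (fun j => if j = i then t * l else 0) ∈ A) :
    minDist F (affineCode F m ↑A) =
      A.inf' hA (fun a => ∏ i, (Fintype.card F - a i)) := by
  obtain ⟨T, hT, hT₀, hTle⟩ := exists_card_pow_notMem_le hl hldvd hkl
  set p : Polynomial F := ∏ c ∈ T, (Polynomial.X - Polynomial.C c) with hp
  have hpdeg : p.natDegree ≤ k := by rw [hp, Polynomial.natDegree_finsetProd_X_sub_C_eq_card, hT]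
  have heval (x : F) : p.eval x ≠ 0 ↔ x ∉ T := by
    simp [hp, Polynomial.eval_prod, Finset.prod_eq_zero_iff, sub_eq_zero]
  set v : (Fin m → F) → F := fun P => p.eval (P i ^ l) with hv
  have hvmem : v ∈ affineCode F m ↑A := eval_pow_mem_affineCode hmem hpdeg
  have hv₀ : v ≠ 0 := fun h => by
    refine (heval 0).2 hT₀ ?_
    simpa [hv, zero_pow (Nat.one_le_iff_ne_zero.1 hl)] using congrFun h 0
  have hvle : hammingNorm v ≤ A.inf' hA (fun a => ∏ i, (Fintype.card F - a i)) := by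
    rw [hFB]
    refine le_trans (le_of_eq ?_) (Nat.mul_le_mul_right _ hTle)
    rw [← card_filter_apply_mem i]
    simp [hammingNorm, hv, heval]
  have hvw : hammingNorm v ∈ {w | ∃ v ∈ affineCode F m ↑A, v ≠ 0 ∧ hammingNorm v = w} :=
    ⟨v, hvmem, hv₀, rfl⟩
  refine le_antisymm ((Nat.sInf_le hvw).trans hvle) (le_csInf ⟨_, hvw⟩ ?_)
  rintro w ⟨u, hu, hu₀, rfl⟩
  exact inf'_le_hammingNorm hA hu hu₀
end
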